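/- For a two-dimensional complex Finsler metric on D: (i) the vertical holomorphic sectional curvature in direction l vanishes, i.e. S_{r̄jh̄k}·l̄^r·l^j·l̄^h·l^k = 0; (ii) S_{r̄jh̄k}·m̄^r·m^j·m̄^h·m^k = I, and I is real-valued; (iii) (∂I/∂η^k)·η^k = −I at every point of D. -/

import Mathlib

open Complex

noncomputable section

namespace CFinsler

/-- A point of `T'M` in local coordinates: `(z, η) ∈ ℂⁿ × ℂⁿ`. -/
abbrev Pt (n : ℕ) := (Fin n → ℂ) × (Fin n → ℂ)

variable {n : ℕ}

/-- Wirtinger derivative `∂f/∂z^k`. -/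
def dz (f : Pt n → ℂ) (k : Fin n) (p : Pt n) : ℂ :=
  (1 / 2) * (fderiv ℝ f p ((Pi.single k 1 : Fin n → ℂ), 0) -
    Complex.I * fderiv ℝ f p ((Pi.single k Complex.I : Fin n → ℂ), 0))

/-- Wirtinger derivative `∂f/∂z̄^k`. -/
def dzbar (f : Pt n → ℂ) (k : Fin n) (p : Pt n) : ℂ :=
  (1 / 2) * (fderiv ℝ f p ((Pi.single k 1 : Fin n → ℂ), 0) +
    Complex.I * fderiv ℝ f p ((Pi.single k Complex.I : Fin n → ℂ), 0))

/-- Wirtinger derivative `∂f/∂η^k`. -/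
def de (f : Pt n → ℂ) (k : Fin n) (p : Pt n) : ℂ :=
  (1 / 2) * (fderiv ℝ f p (0, (Pi.single k 1 : Fin n → ℂ)) -
    Complex.I * fderiv ℝ f p (0, (Pi.single k Complex.I : Fin n → ℂ)))

/-- Wirtinger derivative `∂f/∂η̄^k`. -/
def debar (f : Pt n → ℂ) (k : Fin n) (p : Pt n) : ℂ :=
  (1 / 2) * (fderiv ℝ f p (0, (Pi.single k 1 : Fin n → ℂ)) +
    Complex.I * fderiv ℝ f p (0, (Pi.single k Complex.I : Fin n → ℂ)))

/-- The fundamental metric tensor `g_{i j̄} := ∂²L/∂η^i ∂η̄^j`. -/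
def gm (L : Pt n → ℂ) (i j : Fin n) : Pt n → ℂ := de (debar L j) i

/-- `L` is an `n`-dimensional complex Finsler metric on `D`. -/
structure IsCFM (n : ℕ) (D : Set (Pt n)) (L : Pt n → ℂ) : Prop where
  openD : IsOpen D
  fiber_ne : ∀ p ∈ D, p.2 ≠ 0
  conic : ∀ p ∈ D, ∀ lam : ℂ, lam ≠ 0 → (p.1, lam • p.2) ∈ D
  smooth : ContDiffOn ℝ (⊤ : ℕ∞) L D
  real_im : ∀ p ∈ D, (L p).im = 0
  pos : ∀ p ∈ D, 0 < (L p).re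
  homog : ∀ p ∈ D, ∀ lam : ℂ, lam ≠ 0 →
    L (p.1, lam • p.2) = ((Complex.normSq lam : ℝ) : ℂ) * L p
  hermitian : ∀ p ∈ D, ∀ i j, (starRingEnd ℂ) (gm L i j p) = gm L j i p
  posdef : ∀ p ∈ D, ∀ v : Fin n → ℂ, v ≠ 0 →
    0 < (∑ i, ∑ j, gm L i j p * v i * (starRingEnd ℂ) (v j)).re

variable (L : Pt n → ℂ)

/-- The metric tensor as a matrix at a point. -/
def gmat (p : Pt n) : Matrix (Fin n) (Fin n) ℂ := fun i j => gm L i j p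

/-- The inverse metric tensor `g^{l̄ i}`. -/
def gi (l i : Fin n) (p : Pt n) : ℂ := (gmat L p)⁻¹ l i

/-- The Chern–Finsler nonlinear connection coefficients
`N^i_k := g^{m̄ i} (∂g_{l m̄}/∂z^k) η^l`. -/
def Nc (i k : Fin n) (p : Pt n) : ℂ :=
  ∑ m, ∑ l, gi L m i p * dz (gm L l m) k p * p.2 l

/-- The horizontal derivation `δ_k := ∂/∂z^k − N^j_k ∂/∂η^j`. -/
def del (f : Pt n → ℂ) (k : Fin n) (p : Pt n) : ℂ :=
  dz f k p - ∑ j, Nc L j k p * de f j p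

/-- The conjugate horizontal derivation `δ_k̄ := ∂/∂z̄^k − N̄^j_k ∂/∂η̄^j`. -/
def delbar (f : Pt n → ℂ) (k : Fin n) (p : Pt n) : ℂ :=
  dzbar f k p - ∑ j, (starRingEnd ℂ) (Nc L j k p) * debar f j p

/-- The horizontal Chern–Finsler connection coefficients `L^i_{jk} := g^{l̄ i} δ_k(g_{j l̄})`. -/
def Lc (i j k : Fin n) (p : Pt n) : ℂ := ∑ l, gi L l i p * del L (gm L j l) k p

/-- The vertical Chern–Finsler connection coefficients `C^i_{jk} := g^{l̄ i} ∂g_{j l̄}/∂η^k`. -/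
def Cc (i j k : Fin n) (p : Pt n) : ℂ := ∑ l, gi L l i p * de (gm L j l) k p

/-- The spray coefficients `G^i := ½ N^i_j η^j`. -/
def Gs (i : Fin n) (p : Pt n) : ℂ := (1 / 2) * ∑ j, Nc L i j p * p.2 j

/-- The canonical horizontal derivation `δ̊_k := ∂/∂z^k − (∂G^j/∂η^k) ∂/∂η^j`. -/
def delc (f : Pt n → ℂ) (k : Fin n) (p : Pt n) : ℂ :=
  dz f k p - ∑ j, de (Gs L j) k p * de f j p

/-- `F := √L`. -/
def Fh (p : Pt n) : ℂ := (Real.sqrt ((L p).re) : ℂ)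

/-- `l^i := η^i / F`. -/
def lup (i : Fin n) (p : Pt n) : ℂ := p.2 i / Fh L p

/-- `l_i := g_{i j̄} η̄^j / F`. -/
def llow (i : Fin n) (p : Pt n) : ℂ :=
  (∑ j, gm L i j p * (starRingEnd ℂ) (p.2 j)) / Fh L p

/-- `√g` where `g := det(g_{i j̄})`. -/
def sg (p : Pt n) : ℂ := (Real.sqrt ((gmat L p).det.re) : ℂ)

/-- The metric is Kähler. -/
def IsKahler (D : Set (Pt n)) : Prop := ∀ p ∈ D, ∀ i j k, Lc L i j k p = Lc L i k j p

/-- The metric is weakly Kähler. -/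
def IsWeaklyKahler (D : Set (Pt n)) : Prop :=
  ∀ p ∈ D, ∀ k, (∑ i, ∑ j, ∑ l, gm L i l p * (Lc L i j k p - Lc L i k j p) *
    p.2 j * (starRingEnd ℂ) (p.2 l)) = 0

/-- The metric is purely Hermitian: `g_{i j̄}` does not depend on the fibre variable. -/
def IsPurelyHermitian (D : Set (Pt n)) : Prop :=
  ∀ p ∈ D, ∀ i j k, de (gm L i j) k p = 0 ∧ debar (gm L i j) k p = 0

/-- The metric is a complex Berwald metric: Kähler with `L^i_{jk}` independent of the
fibre variable. -/
def IsBerwald (D : Set (Pt n)) : Prop :=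
  IsKahler L D ∧ ∀ p ∈ D, ∀ i j k l, de (Lc L i j k) l p = 0 ∧ debar (Lc L i j k) l p = 0

/-- The metric is a complex Landsberg metric: the Berwald and Rund connections coincide. -/
def IsLandsberg (D : Set (Pt n)) : Prop :=
  ∀ p ∈ D, ∀ i j k, de (de (Gs L i) k) j p =
    (1 / 2) * ∑ l, gi L l i p * (delc L (gm L j l) k p + delc L (gm L k l) j p)

/-- `m^i` of the local complex Berwald frame: `m¹ = −l₂/√g`, `m² = l₁/√g`. -/
def mup (L : Pt 2 → ℂ) (i : Fin 2) (p : Pt 2) : ℂ :=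
  if i = 0 then -(llow L 1 p) / sg L p else llow L 0 p / sg L p

/-- `m_i := g_{i j̄} m̄^j`. -/
def mlow (L : Pt 2 → ℂ) (i : Fin 2) (p : Pt 2) : ℂ :=
  ∑ j, gm L i j p * (starRingEnd ℂ) (mup L j p)

/-- `A := m^j m^k l_h C^h_{kj}`. -/
def sA (L : Pt 2 → ℂ) (p : Pt 2) : ℂ :=
  ∑ j, ∑ k, ∑ h, mup L j p * mup L k p * llow L h p * Cc L h k j p

/-- `B := m_h m^k m^j C^h_{jk}`. -/
def sB (L : Pt 2 → ℂ) (p : Pt 2) : ℂ :=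
  ∑ j, ∑ k, ∑ h, mlow L h p * mup L k p * mup L j p * Cc L h j k p

/-- `J := l^j l^k l_i L^i_{jk}`. -/
def sJ (L : Pt 2 → ℂ) (p : Pt 2) : ℂ :=
  ∑ j, ∑ k, ∑ i, lup L j p * lup L k p * llow L i p * Lc L i j k p

/-- `U := m^j l^k l_i L^i_{jk}`. -/
def sU (L : Pt 2 → ℂ) (p : Pt 2) : ℂ :=
  ∑ j, ∑ k, ∑ i, mup L j p * lup L k p * llow L i p * Lc L i j k p

/-- `V := l^j m^k l_i L^i_{jk}`. -/
def sV (L : Pt 2 → ℂ) (p : Pt 2) : ℂ :=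
  ∑ j, ∑ k, ∑ i, lup L j p * mup L k p * llow L i p * Lc L i j k p

/-- `X := m^j m^k l_i L^i_{jk}`. -/
def sX (L : Pt 2 → ℂ) (p : Pt 2) : ℂ :=
  ∑ j, ∑ k, ∑ i, mup L j p * mup L k p * llow L i p * Lc L i j k p

/-- `O := l^j l^k m_i L^i_{jk}`. -/
def sO (L : Pt 2 → ℂ) (p : Pt 2) : ℂ :=
  ∑ j, ∑ k, ∑ i, lup L j p * lup L k p * mlow L i p * Lc L i j k p

/-- `Y := m^j l^k m_i L^i_{jk}`. -/
def sY (L : Pt 2 → ℂ) (p : Pt 2) : ℂ :=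
  ∑ j, ∑ k, ∑ i, mup L j p * lup L k p * mlow L i p * Lc L i j k p

/-- `E := l^j m^k m_i L^i_{jk}`. -/
def sE (L : Pt 2 → ℂ) (p : Pt 2) : ℂ :=
  ∑ j, ∑ k, ∑ i, lup L j p * mup L k p * mlow L i p * Lc L i j k p

/-- `H := m^j m^k m_i L^i_{jk}`. -/
def sH (L : Pt 2 → ℂ) (p : Pt 2) : ℂ :=
  ∑ j, ∑ k, ∑ i, mup L j p * mup L k p * mlow L i p * Lc L i j k p

/-- The vertical curvature invariant `I := −(∂B/∂η̄^s) m̄^s − B B̄/2`. -/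
def vI (L : Pt 2 → ℂ) (p : Pt 2) : ℂ :=
  -(∑ s, debar (sB L) s p * (starRingEnd ℂ) (mup L s p)) -
    sB L p * (starRingEnd ℂ) (sB L p) / 2

/-- The `v v̄`-Riemann type tensor `S_{r̄ j h̄ k} := −g_{i r̄} ∂C^i_{jk}/∂η̄^h`. -/
def Sv (L : Pt 2 → ℂ) (r j h k : Fin 2) (p : Pt 2) : ℂ :=
  -∑ i, gm L i r p * debar (Cc L i j k) h p

/-- The `h h̄`-Riemann type tensor
`R_{r̄ j h̄ k} := g_{i r̄} (−δ_h̄(L^i_{jk}) − δ_h̄(N^l_k) C^i_{jl})`. -/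
def Rh (L : Pt 2 → ℂ) (r j h k : Fin 2) (p : Pt 2) : ℂ :=
  ∑ i, gm L i r p *
    (-(delbar L (Lc L i j k) h p) - ∑ l, delbar L (Nc L l k) h p * Cc L i j l p)

/-- The horizontal curvature invariant `K := −(1/F) δ_k̄(J) η̄^k`. -/
def hK (L : Pt 2 → ℂ) (p : Pt 2) : ℂ :=
  -(1 / Fh L p) * ∑ k, delbar L (sJ L) k p * (starRingEnd ℂ) (p.2 k)

/-- The horizontal curvature invariant
`W := −δ_s̄(H) m̄^s − ½ H (V̄+H̄) − B F δ_s̄(E) m̄^s`. -/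
def hW (L : Pt 2 → ℂ) (p : Pt 2) : ℂ :=
  -(∑ s, delbar L (sH L) s p * (starRingEnd ℂ) (mup L s p)) -
    (1 / 2) * sH L p * ((starRingEnd ℂ) (sV L p) + (starRingEnd ℂ) (sH L p)) -
    sB L p * Fh L p * ∑ s, delbar L (sE L) s p * (starRingEnd ℂ) (mup L s p)

/-- The weak symmetry condition `R_{0̄ k 0̄ 0} = R_{0̄ 0 0̄ k}`, i.e.
`R_{r̄ k h̄ s} η̄^r η̄^h η^s = R_{r̄ s h̄ k} η̄^r η^s η̄^h`. -/
def WeakSym (L : Pt 2 → ℂ) (D : Set (Pt 2)) : Prop :=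
  ∀ p ∈ D, ∀ k,
    (∑ r, ∑ h, ∑ s, Rh L r k h s p * (starRingEnd ℂ) (p.2 r) *
      (starRingEnd ℂ) (p.2 h) * p.2 s) =
    ∑ r, ∑ s, ∑ h, Rh L r s h k p * (starRingEnd ℂ) (p.2 r) * p.2 s *
      (starRingEnd ℂ) (p.2 h)



/-- `C^∞` smoothness of a complex-valued function on a set of points. -/
abbrev Sm (D : Set (Pt n)) (f : Pt n → ℂ) : Prop := ContDiffOn ℝ (⊤ : ℕ∞) f D

/-- The functional of the differential that computes `∂/∂η^k`. -/
def deL (k : Fin n) : (Pt n →L[ℝ] ℂ) →ₗ[ℂ] ℂ where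
  toFun T := (1 / 2) * (T (0, Pi.single k 1) - Complex.I * T (0, Pi.single k Complex.I))
  map_add' _ _ := by simp only [add_apply]; ring
  map_smul' _ _ := by simp only [smul_apply, smul_eq_mul, RingHom.id_apply]; ring

/-- The functional of the differential that computes `∂/∂η̄^k`. -/
def debarL (k : Fin n) : (Pt n →L[ℝ] ℂ) →ₗ[ℂ] ℂ where
  toFun T := (1 / 2) * (T (0, Pi.single k 1) + Complex.I * T (0, Pi.single k Complex.I))
  map_add' _ _ := by simp only [add_apply]; ring
  map_smul' _ _ := by simp only [smul_apply, smul_eq_mul, RingHom.id_apply]; ring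

theorem de_eq (f : Pt n → ℂ) (k : Fin n) (p : Pt n) : de f k p = deL k (fderiv ℝ f p) := rfl

theorem debar_eq (f : Pt n → ℂ) (k : Fin n) (p : Pt n) :
    debar f k p = debarL k (fderiv ℝ f p) := rfl

theorem map_fderiv_mul (T : (Pt n →L[ℝ] ℂ) →ₗ[ℂ] ℂ) {f g : Pt n → ℂ} {p : Pt n}
    (hf : DifferentiableAt ℝ f p) (hg : DifferentiableAt ℝ g p) :
    T (fderiv ℝ (fun q => f q * g q) p) =
      f p * T (fderiv ℝ g p) + g p * T (fderiv ℝ f p) := by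
  rw [fderiv_fun_mul hf hg, map_add, map_smul, map_smul, smul_eq_mul, smul_eq_mul]

theorem map_fderiv_sum (T : (Pt n →L[ℝ] ℂ) →ₗ[ℂ] ℂ) {ι : Type*} [Fintype ι]
    {f : ι → Pt n → ℂ} {p : Pt n} (hf : ∀ i, DifferentiableAt ℝ (f i) p) :
    T (fderiv ℝ (fun q => ∑ i, f i q) p) = ∑ i, T (fderiv ℝ (f i) p) := by
  rw [fderiv_fun_sum fun i _ => hf i, map_sum]

theorem map_fderiv_neg (T : (Pt n →L[ℝ] ℂ) →ₗ[ℂ] ℂ) (f : Pt n → ℂ) (p : Pt n) :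
    T (fderiv ℝ (fun q => -f q) p) = -T (fderiv ℝ f p) := by
  rw [fderiv_fun_neg, map_neg]

theorem fderiv_eq_of_eqOn {D : Set (Pt n)} (hD : IsOpen D) {f g : Pt n → ℂ}
    (h : ∀ q ∈ D, f q = g q) {p : Pt n} (hp : p ∈ D) : fderiv ℝ f p = fderiv ℝ g p :=
  Filter.EventuallyEq.fderiv_eq (Filter.eventually_of_mem (hD.mem_nhds hp) h)

theorem Sm.diff {D : Set (Pt n)} (hD : IsOpen D) {f : Pt n → ℂ} (hf : Sm D f) {p : Pt n}
    (hp : p ∈ D) : DifferentiableAt ℝ f p :=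
  (hf.contDiffAt (hD.mem_nhds hp)).differentiableAt (by simp)

theorem Sm.conj {D : Set (Pt n)} {f : Pt n → ℂ} (hf : Sm D f) :
    Sm D (fun q => (starRingEnd ℂ) (f q)) :=
  Complex.conjCLE.contDiff.comp_contDiffOn hf

theorem Sm.fderiv_apply {D : Set (Pt n)} (hD : IsOpen D) {f : Pt n → ℂ} (hf : Sm D f)
    (v : Pt n) : Sm D (fun q => fderiv ℝ f q v) :=
  (ContDiffOn.fderiv_of_isOpen (m := (⊤ : ℕ∞)) hf hD (by simp)).clm_apply contDiffOn_const

theorem Sm.de {D : Set (Pt n)} (hD : IsOpen D) {f : Pt n → ℂ} (hf : Sm D f) (k : Fin n) :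
    Sm D (de f k) :=
  contDiffOn_const.mul ((hf.fderiv_apply hD _).sub (contDiffOn_const.mul (hf.fderiv_apply hD _)))

theorem Sm.debar {D : Set (Pt n)} (hD : IsOpen D) {f : Pt n → ℂ} (hf : Sm D f) (k : Fin n) :
    Sm D (debar f k) :=
  contDiffOn_const.mul ((hf.fderiv_apply hD _).add (contDiffOn_const.mul (hf.fderiv_apply hD _)))

/-- Directional derivatives of a smooth function commute. -/
theorem Sm.fderiv_fderiv_comm {D : Set (Pt n)} (hD : IsOpen D) {f : Pt n → ℂ} (hf : Sm D f)
    {p : Pt n} (hp : p ∈ D) (v w : Pt n) :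
    fderiv ℝ (fun q => fderiv ℝ f q v) p w = fderiv ℝ (fun q => fderiv ℝ f q w) p v := by
  have hs := (hf.contDiffAt (hD.mem_nhds hp)).isSymmSndFDerivAt (by
    simpa using WithTop.coe_le_coe.2 (le_top : (2 : ℕ∞) ≤ ⊤))
  have hd : DifferentiableAt ℝ (fderiv ℝ f) p :=
    ((ContDiffOn.fderiv_of_isOpen (m := (⊤ : ℕ∞)) hf hD (by simp)).contDiffAt
      (hD.mem_nhds hp)).differentiableAt (by simp)
  have key (u : Pt n) : fderiv ℝ (fun q => fderiv ℝ f q u) p =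
      (ContinuousLinearMap.apply ℝ ℂ u).comp (fderiv ℝ (fderiv ℝ f) p) :=
    ((ContinuousLinearMap.apply ℝ ℂ u).hasFDerivAt.comp p hd.hasFDerivAt).fderiv
  rw [key, key]
  exact hs w v

theorem fderiv_add_const_mul {f g : Pt n → ℂ} {p : Pt n} (a b : ℂ)
    (hf : DifferentiableAt ℝ f p) (hg : DifferentiableAt ℝ g p) (w : Pt n) :
    fderiv ℝ (fun q => a * (f q + b * g q)) p w =
      a * (fderiv ℝ f p w + b * fderiv ℝ g p w) := by
  rw [fderiv_const_mul (hf.fun_add (hg.const_mul b)), fderiv_fun_add hf (hg.const_mul b),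
    fderiv_const_mul hg]
  simp [mul_add]

theorem wirtinger_comm {D : Set (Pt n)} (hD : IsOpen D) {f : Pt n → ℂ} (hf : Sm D f)
    {p : Pt n} (hp : p ∈ D) (a b c : ℂ) (v v' w w' : Pt n) :
    c * (fderiv ℝ (fun q => c * (fderiv ℝ f q v + a * fderiv ℝ f q v')) p w +
        b * fderiv ℝ (fun q => c * (fderiv ℝ f q v + a * fderiv ℝ f q v')) p w') =
      c * (fderiv ℝ (fun q => c * (fderiv ℝ f q w + b * fderiv ℝ f q w')) p v +
        a * fderiv ℝ (fun q => c * (fderiv ℝ f q w + b * fderiv ℝ f q w')) p v') := by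
  have hd (u : Pt n) := (hf.fderiv_apply hD u).diff hD hp
  simp only [fderiv_add_const_mul _ _ (hd _) (hd _)]
  rw [hf.fderiv_fderiv_comm hD hp v w, hf.fderiv_fderiv_comm hD hp v' w,
    hf.fderiv_fderiv_comm hD hp v w', hf.fderiv_fderiv_comm hD hp v' w']
  ring

theorem de_eq_add (f : Pt n → ℂ) (k : Fin n) : de f k = fun p => (1 / 2) *
    (fderiv ℝ f p (0, (Pi.single k 1 : Fin n → ℂ)) +
      (-Complex.I) * fderiv ℝ f p (0, (Pi.single k Complex.I : Fin n → ℂ))) := by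
  funext p; simp only [de]; ring

theorem Sm.de_comm {D : Set (Pt n)} (hD : IsOpen D) {f : Pt n → ℂ} (hf : Sm D f)
    {p : Pt n} (hp : p ∈ D) (j k : Fin n) : CFinsler.de (CFinsler.de f j) k p =
      CFinsler.de (CFinsler.de f k) j p := by
  simp only [de_eq_add]
  exact wirtinger_comm hD hf hp _ _ _ _ _ _ _

theorem Sm.debar_de {D : Set (Pt n)} (hD : IsOpen D) {f : Pt n → ℂ} (hf : Sm D f)
    {p : Pt n} (hp : p ∈ D) (j k : Fin n) : CFinsler.debar (CFinsler.de f j) k p =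
      CFinsler.de (CFinsler.debar f k) j p := by
  simp only [de_eq_add]
  exact wirtinger_comm hD hf hp _ _ _ _ _ _ _

theorem fderiv_conj (f : Pt n → ℂ) (p v : Pt n) :
    fderiv ℝ (fun q => (starRingEnd ℂ) (f q)) p v = (starRingEnd ℂ) (fderiv ℝ f p v) := by
  have := Complex.conjCLE.comp_fderiv (f := f) (x := p)
  have h2 : (Complex.conjCLE ∘ f) = fun q => (starRingEnd ℂ) (f q) := by
    funext q; simp
  rw [h2] at this
  rw [this]; simp

theorem de_conj (f : Pt n → ℂ) (k : Fin n) (p : Pt n) :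
    de (fun q => (starRingEnd ℂ) (f q)) k p = (starRingEnd ℂ) (debar f k p) := by
  simp only [de, debar, fderiv_conj, map_mul, map_add, map_div₀, map_one, map_ofNat, conj_I]
  ring

theorem debar_conj (f : Pt n → ℂ) (k : Fin n) (p : Pt n) :
    debar (fun q => (starRingEnd ℂ) (f q)) k p = (starRingEnd ℂ) (de f k p) := by
  simp only [de, debar, fderiv_conj, map_mul, map_sub, map_div₀, map_one, map_ofNat, conj_I]
  ring

/-- `f` scales by the character `χ` under fibre dilations. -/
def Hg (D : Set (Pt n)) (χ : ℂ → ℂ) (f : Pt n → ℂ) : Prop :=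
  ∀ p ∈ D, ∀ lam : ℂ, lam ≠ 0 → f (p.1, lam • p.2) = χ lam * f p

/-- The dilation of the fibre by a nonzero complex number. -/
def dil (lam : ℂ) (h : lam ≠ 0) : Pt n ≃L[ℝ] Pt n :=
  (ContinuousLinearEquiv.refl ℝ (Fin n → ℂ)).prodCongr
    ((ContinuousLinearEquiv.smulLeft (Units.mk0 lam h) :
      (Fin n → ℂ) ≃L[ℂ] (Fin n → ℂ)).restrictScalars ℝ)

theorem dil_apply (lam : ℂ) (h : lam ≠ 0) (p : Pt n) : dil lam h p = (p.1, lam • p.2) := rfl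

theorem Hg.fderiv {D : Set (Pt n)} (hD : IsOpen D) {χ : ℂ → ℂ} {f : Pt n → ℂ} (hf : Hg D χ f)
    {p : Pt n} (hp : p ∈ D) {lam : ℂ} (h : lam ≠ 0) (v : Fin n → ℂ) :
    fderiv ℝ f (p.1, lam • p.2) (0, v) = χ lam * fderiv ℝ f p (0, lam⁻¹ • v) := by
  have h1 : _root_.fderiv ℝ (f ∘ dil lam h) p = _root_.fderiv ℝ (fun q => χ lam * f q) p :=
    fderiv_eq_of_eqOn hD (fun q hq => hf q hq lam h) hp
  rw [ContinuousLinearEquiv.comp_right_fderiv] at h1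
  have h2 := congrArg (fun T : Pt n →L[ℝ] ℂ => T (0, lam⁻¹ • v)) h1
  have h3 : _root_.fderiv ℝ (fun q => χ lam * f q) p = χ lam • _root_.fderiv ℝ f p := by
    exact congrFun (fderiv_const_smul_field (𝕜 := ℝ) (f := f) (χ lam)) p
  rw [h3] at h2
  simpa [dil_apply, smul_smul, h] using h2

theorem clm_smul (T : Pt n →L[ℝ] ℂ) (w : ℂ) (v : Fin n → ℂ) :
    T (0, w • v) = w.re * T (0, v) + w.im * T (0, Complex.I • v) := by
  have : ((0, w • v) : Pt n) = w.re • (0, v) + w.im • (0, Complex.I • v) := by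
    ext i
    · simp
    · simp only [Pi.smul_apply, Prod.smul_mk, Prod.mk_add_mk, Pi.add_apply, smul_eq_mul, real_smul]
      conv_lhs => rw [← Complex.re_add_im w]
      ring
  rw [this, map_add, map_smul, map_smul, real_smul, real_smul]

theorem single_I (k : Fin n) :
    (Pi.single k Complex.I : Fin n → ℂ) = Complex.I • (Pi.single k 1 : Fin n → ℂ) := by
  rw [← Pi.single_smul]; simp

theorem Hg.de {D : Set (Pt n)} (hD : IsOpen D) {χ : ℂ → ℂ} {f : Pt n → ℂ} (hf : Hg D χ f)
    (k : Fin n) : Hg D (fun lam => χ lam * lam⁻¹) (de f k) := by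
  intro p hp lam h
  simp only [CFinsler.de, hf.fderiv hD hp h, single_I, smul_smul]
  rw [clm_smul _ lam⁻¹, clm_smul _ (lam⁻¹ * Complex.I)]
  conv_rhs => rw [← Complex.re_add_im lam⁻¹]
  simp only [mul_re, mul_im, I_re, I_im, ofReal_sub, ofReal_add, ofReal_mul, ofReal_zero, ofReal_one]
  linear_combination ((1/2) * χ lam * (lam⁻¹).im * (_root_.fderiv ℝ f p (0, Complex.I • Pi.single k 1))) * I_sq

theorem Hg.debar {D : Set (Pt n)} (hD : IsOpen D) {χ : ℂ → ℂ} {f : Pt n → ℂ} (hf : Hg D χ f)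
    (k : Fin n) : Hg D (fun lam => χ lam * (starRingEnd ℂ) lam⁻¹) (debar f k) := by
  intro p hp lam h
  simp only [CFinsler.debar, hf.fderiv hD hp h, single_I, smul_smul]
  rw [clm_smul _ lam⁻¹, clm_smul _ (lam⁻¹ * Complex.I)]
  have : (starRingEnd ℂ) lam⁻¹ = (lam⁻¹).re - (lam⁻¹).im * Complex.I := by
    conv_lhs => rw [← Complex.re_add_im lam⁻¹]
    simp only [map_add, map_mul, conj_ofReal, conj_I]; ring
  rw [this]
  simp only [mul_re, mul_im, I_re, I_im, ofReal_sub, ofReal_add, ofReal_mul, ofReal_zero, ofReal_one]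
  linear_combination ((1/2) * χ lam * (lam⁻¹).im * (_root_.fderiv ℝ f p (0, Complex.I • Pi.single k 1))) * I_sq

theorem Hg.mul {D : Set (Pt n)} {χ ψ : ℂ → ℂ} {f g : Pt n → ℂ} (hf : Hg D χ f) (hg : Hg D ψ g) :
    Hg D (fun lam => χ lam * ψ lam) (fun q => f q * g q) := by
  intro p hp lam h
  simp only [hf p hp lam h, hg p hp lam h]; ring

theorem Hg.conj {D : Set (Pt n)} {χ : ℂ → ℂ} {f : Pt n → ℂ} (hf : Hg D χ f) :
    Hg D (fun lam => (starRingEnd ℂ) (χ lam)) (fun q => (starRingEnd ℂ) (f q)) := by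
  intro p hp lam h
  simp only [hf p hp lam h, map_mul]

theorem Hg.sum {D : Set (Pt n)} {χ : ℂ → ℂ} {ι : Type*} [Fintype ι] {f : ι → Pt n → ℂ}
    (hf : ∀ i, Hg D χ (f i)) : Hg D χ (fun q => ∑ i, f i q) := by
  intro p hp lam h
  simp only [hf _ p hp lam h, Finset.mul_sum]

theorem Hg.congr {D : Set (Pt n)} {χ ψ : ℂ → ℂ} {f : Pt n → ℂ} (hf : Hg D χ f)
    (h : ∀ lam, lam ≠ 0 → χ lam = ψ lam) : Hg D ψ f := by
  intro p hp lam hl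
  rw [hf p hp lam hl, h lam hl]

/-- Euler's relation in the direction of a complex multiple of the fibre coordinate. -/
theorem Hg.euler {D : Set (Pt n)} {χ : ℂ → ℂ} {f : Pt n → ℂ} (hf : Hg D χ f) {p : Pt n}
    (hp : p ∈ D) (hd : DifferentiableAt ℝ f p) {χ' : ℂ →L[ℝ] ℂ} (hχ : HasFDerivAt χ χ' 1)
    (w : ℂ) : _root_.fderiv ℝ f p (0, w • p.2) = χ' w * f p := by
  have h0 : HasFDerivAt (fun lam : ℂ => ((p.1, lam • p.2) : Pt n))
      ((0 : ℂ →L[ℝ] (Fin n → ℂ)).prod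
        (((ContinuousLinearMap.id ℂ ℂ).smulRight p.2).restrictScalars ℝ)) 1 :=
    (hasFDerivAt_const p.1 (1 : ℂ)).prodMk
      (((ContinuousLinearMap.id ℂ ℂ).smulRight p.2).restrictScalars ℝ).hasFDerivAt
  have hp1 : ((p.1, (1 : ℂ) • p.2) : Pt n) = p := by simp
  have h1 := HasFDerivAt.comp (1 : ℂ) (by rw [hp1]; exact hd.hasFDerivAt) h0
  have h2 : HasFDerivAt (fun lam : ℂ => χ lam * f p) (f p • χ') 1 := by
    simpa using hχ.mul_const' (f p)
  have h3 := h2.congr_of_eventuallyEq (f₁ := f ∘ fun lam : ℂ => ((p.1, lam • p.2) : Pt n))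
    (Filter.eventually_of_mem (isOpen_ne.mem_nhds one_ne_zero) fun lam hl => hf p hp lam hl)
  have h4 := congrArg (fun T : ℂ →L[ℝ] ℂ => T w) (h1.unique h3)
  simpa [mul_comm] using h4

theorem map_fibre (T : Pt n →L[ℝ] ℂ) (w : Fin n → ℂ) :
    T (0, w) = ∑ k, ((w k).re * T (0, Pi.single k 1) + (w k).im * T (0, Pi.single k Complex.I)) := by
  have : ((0, w) : Pt n) = ∑ k, ((0, w k • (Pi.single k 1 : Fin n → ℂ)) : Pt n) := by
    ext i
    · simp [Prod.fst_sum]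
    · simp [Prod.snd_sum, ← Pi.single_smul]
  rw [this, map_sum]
  exact Finset.sum_congr rfl fun k _ => by rw [clm_smul, single_I]

theorem sum_de_mul (f : Pt n → ℂ) (p : Pt n) (w : Fin n → ℂ) : ∑ k, de f k p * w k =
    (1 / 2) * (fderiv ℝ f p (0, w) - Complex.I * fderiv ℝ f p (0, Complex.I • w)) := by
  rw [map_fibre, map_fibre, Finset.mul_sum, ← Finset.sum_sub_distrib, Finset.mul_sum]
  refine Finset.sum_congr rfl fun k _ => ?_
  simp only [de, Pi.smul_apply, smul_eq_mul, I_mul_re, I_mul_im, ofReal_neg]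
  conv_lhs => rw [← Complex.re_add_im (w k)]
  linear_combination (-(1/2) * (w k).im * fderiv ℝ f p (0, Pi.single k Complex.I)) * I_sq

theorem sum_debar_mul (f : Pt n → ℂ) (p : Pt n) (w : Fin n → ℂ) :
    ∑ k, debar f k p * (starRingEnd ℂ) (w k) =
    (1 / 2) * (fderiv ℝ f p (0, w) + Complex.I * fderiv ℝ f p (0, Complex.I • w)) := by
  rw [map_fibre, map_fibre, Finset.mul_sum, ← Finset.sum_add_distrib, Finset.mul_sum]
  refine Finset.sum_congr rfl fun k _ => ?_
  have : (starRingEnd ℂ) (w k) = (w k).re - (w k).im * Complex.I := by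
    conv_lhs => rw [← Complex.re_add_im (w k)]
    simp only [map_add, map_mul, conj_ofReal, conj_I]; ring
  rw [this]
  simp only [debar, Pi.smul_apply, smul_eq_mul, I_mul_re, I_mul_im, ofReal_neg]
  linear_combination (-(1/2) * (w k).im * fderiv ℝ f p (0, Pi.single k Complex.I)) * I_sq

theorem Hg.sum_de {D : Set (Pt n)} {χ : ℂ → ℂ} {f : Pt n → ℂ} (hf : Hg D χ f) {p : Pt n}
    (hp : p ∈ D) (hd : DifferentiableAt ℝ f p) {χ' : ℂ →L[ℝ] ℂ} (hχ : HasFDerivAt χ χ' 1) :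
    ∑ k, CFinsler.de f k p * p.2 k = (1 / 2) * (χ' 1 - Complex.I * χ' Complex.I) * f p := by
  have h1 := hf.euler hp hd hχ 1
  rw [one_smul] at h1
  rw [sum_de_mul, h1, hf.euler hp hd hχ]; ring

theorem Hg.sum_debar {D : Set (Pt n)} {χ : ℂ → ℂ} {f : Pt n → ℂ} (hf : Hg D χ f) {p : Pt n}
    (hp : p ∈ D) (hd : DifferentiableAt ℝ f p) {χ' : ℂ →L[ℝ] ℂ} (hχ : HasFDerivAt χ χ' 1) :
    ∑ k, CFinsler.debar f k p * (starRingEnd ℂ) (p.2 k) =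
      (1 / 2) * (χ' 1 + Complex.I * χ' Complex.I) * f p := by
  have h1 := hf.euler hp hd hχ 1
  rw [one_smul] at h1
  rw [sum_debar_mul, h1, hf.euler hp hd hχ]; ring

/-- The antiholomorphic fibre derivative in the direction `c`. -/
def vbar (c : Fin n → ℂ) : (Pt n →L[ℝ] ℂ) →ₗ[ℂ] ℂ := ∑ s, c s • debarL s

theorem vbar_fderiv (c : Fin n → ℂ) (f : Pt n → ℂ) (p : Pt n) :
    vbar c (fderiv ℝ f p) = ∑ s, debar f s p * c s := by
  simp only [vbar, LinearMap.sum_apply, LinearMap.smul_apply, smul_eq_mul, debar_eq, mul_comm]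

namespace IsCFM

section general

variable {D : Set (Pt n)} {L : Pt n → ℂ} {p : Pt n}

theorem sm_L (hL : IsCFM n D L) : Sm D L := hL.smooth

theorem sm_gm (hL : IsCFM n D L) (i j : Fin n) : Sm D (gm L i j) :=
  (hL.sm_L.debar hL.openD j).de hL.openD i

theorem de_gm_comm (hL : IsCFM n D L) (hp : p ∈ D) (j r k : Fin n) :
    de (gm L j r) k p = de (gm L k r) j p :=
  (hL.sm_L.debar hL.openD r).de_comm hL.openD hp j k

theorem gm_eq (hL : IsCFM n D L) (hp : p ∈ D) (i j : Fin n) :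
    gm L i j p = debar (de L i) j p :=
  (hL.sm_L.debar_de hL.openD hp i j).symm

theorem debar_gm (hL : IsCFM n D L) (hp : p ∈ D) (i j h : Fin n) :
    debar (gm L i j) h p = (starRingEnd ℂ) (de (gm L j i) h p) := by
  rw [← debar_conj, debar_eq, debar_eq]
  rw [fderiv_eq_of_eqOn hL.openD (fun q hq => (hL.hermitian q hq j i).symm) hp]

theorem hg_L (hL : IsCFM n D L) : Hg D (fun lam => lam * (starRingEnd ℂ) lam) L := by
  intro p hp lam h
  simp only [hL.homog p hp lam h, Complex.mul_conj]

theorem hg_de (hL : IsCFM n D L) (i : Fin n) : Hg D (fun lam => (starRingEnd ℂ) lam) (de L i) :=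
  (hL.hg_L.de hL.openD i).congr fun lam h => by field_simp

theorem hg_debar (hL : IsCFM n D L) (i : Fin n) : Hg D (fun lam => lam) (debar L i) :=
  (hL.hg_L.debar hL.openD i).congr fun lam h => by
    have : (starRingEnd ℂ) lam ≠ 0 := by simpa using h
    rw [map_inv₀]; field_simp

theorem hg_gm (hL : IsCFM n D L) (i j : Fin n) : Hg D (fun _ => 1) (gm L i j) :=
  ((hL.hg_debar j).de hL.openD i).congr fun lam h => by field_simp

theorem sum_de_gm (hL : IsCFM n D L) (hp : p ∈ D) (j r : Fin n) :
    ∑ k, de (gm L j r) k p * p.2 k = 0 := by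
  rw [(hL.hg_gm j r).sum_de hp ((hL.sm_gm j r).diff hL.openD hp) (hasFDerivAt_const _ _)]
  simp

theorem sum_gm_conj (hL : IsCFM n D L) (hp : p ∈ D) (i : Fin n) :
    ∑ j, gm L i j p * (starRingEnd ℂ) (p.2 j) = de L i p := by
  simp only [hL.gm_eq hp]
  rw [(hL.hg_de i).sum_debar hp ((hL.sm_L.de hL.openD i).diff hL.openD hp)
    Complex.conjCLE.hasFDerivAt]
  simp
  ring

theorem sum_gm (hL : IsCFM n D L) (hp : p ∈ D) (j : Fin n) :
    ∑ i, gm L i j p * p.2 i = debar L j p := by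
  simp only [gm]
  rw [(hL.hg_debar j).sum_de hp ((hL.sm_L.debar hL.openD j).diff hL.openD hp) (hasFDerivAt_id _)]
  simp
  ring

theorem sum_de_L (hL : IsCFM n D L) (hp : p ∈ D) : ∑ i, de L i p * p.2 i = L p := by
  rw [hL.hg_L.sum_de hp (hL.sm_L.diff hL.openD hp)
    ((hasFDerivAt_id (𝕜 := ℝ) (1 : ℂ)).mul Complex.conjCLE.hasFDerivAt)]
  simp
  ring

theorem Fh_mul (hL : IsCFM n D L) (hp : p ∈ D) : Fh L p * Fh L p = L p := by
  rw [Fh, ← ofReal_mul, Real.mul_self_sqrt (hL.pos p hp).le]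
  apply Complex.ext <;> simp [hL.real_im p hp]

theorem Fh_ne (hL : IsCFM n D L) (hp : p ∈ D) : Fh L p ≠ 0 := by
  rw [Fh, ofReal_ne_zero]
  exact (Real.sqrt_pos.2 (hL.pos p hp)).ne'

theorem sm_sqrt {f : Pt n → ℂ} (hf : Sm D f) (h : ∀ q ∈ D, 0 < (f q).re) :
    Sm D (fun q => (Real.sqrt (f q).re : ℂ)) :=
  Complex.ofRealCLM.contDiff.comp_contDiffOn
    ((Complex.reCLM.contDiff.comp_contDiffOn hf).sqrt fun q hq => (h q hq).ne')

theorem sm_Fh (hL : IsCFM n D L) : Sm D (Fh L) := sm_sqrt hL.sm_L hL.pos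

theorem llow_eq (hL : IsCFM n D L) (hp : p ∈ D) (i : Fin n) :
    llow L i p = de L i p / Fh L p := by
  rw [llow, hL.sum_gm_conj hp]

theorem sm_llow (hL : IsCFM n D L) (i : Fin n) : Sm D (llow L i) :=
  ((hL.sm_L.de hL.openD i).mul (hL.sm_Fh.inv fun _ hq => hL.Fh_ne hq)).congr fun q hq => by
    rw [hL.llow_eq hq]; rfl

theorem conj_llow (hL : IsCFM n D L) (hp : p ∈ D) (i : Fin n) :
    (starRingEnd ℂ) (llow L i p) = debar L i p / Fh L p := by
  rw [← hL.sum_gm hp]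
  simp only [llow, Fh, map_div₀, map_sum, map_mul, conj_conj, conj_ofReal, hL.hermitian p hp]

theorem hg_Fh (hL : IsCFM n D L) : Hg D (fun lam => (‖lam‖ : ℂ)) (Fh L) := by
  intro p hp lam h
  rw [Fh, hL.homog p hp lam h, re_ofReal_mul, Real.sqrt_mul (normSq_nonneg _), ofReal_mul]
  rfl

theorem gmat_dil (hL : IsCFM n D L) (hp : p ∈ D) {lam : ℂ} (h : lam ≠ 0) :
    gmat L (p.1, lam • p.2) = gmat L p := by
  funext i j
  simp only [gmat, hL.hg_gm i j p hp lam h, one_mul]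

theorem hg_gi (hL : IsCFM n D L) (i j : Fin n) : Hg D (fun _ => 1) (gi L i j) := by
  intro p hp lam h
  rw [gi, hL.gmat_dil hp h, one_mul, gi]

theorem hg_sg (hL : IsCFM n D L) : Hg D (fun _ => 1) (sg L) := by
  intro p hp lam h
  rw [sg, hL.gmat_dil hp h, one_mul, sg]

theorem hg_Cc (hL : IsCFM n D L) (i j k : Fin n) : Hg D (fun lam => lam⁻¹) (Cc L i j k) :=
  Hg.sum fun l => ((hL.hg_gi l i).mul ((hL.hg_gm j l).de hL.openD k)).congr fun lam _ => by simp

theorem hg_llow (hL : IsCFM n D L) (i : Fin n) :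
    Hg D (fun lam => (starRingEnd ℂ) lam / ‖lam‖) (llow L i) := by
  intro p hp lam h
  rw [hL.llow_eq hp, hL.llow_eq (hL.conic p hp lam h), hL.hg_de i p hp lam h,
    hL.hg_Fh p hp lam h, mul_div_mul_comm]

end general

section dimTwo

variable {D : Set (Pt 2)} {L : Pt 2 → ℂ} {p : Pt 2}

theorem det_gmat (L : Pt 2 → ℂ) (p : Pt 2) :
    (gmat L p).det = gm L 0 0 p * gm L 1 1 p - gm L 0 1 p * gm L 1 0 p :=
  Matrix.det_fin_two _

theorem det_im (hL : IsCFM 2 D L) (hp : p ∈ D) : (gmat L p).det.im = 0 := by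
  rw [← Complex.conj_eq_iff_im, det_gmat]
  simp only [map_sub, map_mul, hL.hermitian p hp]
  ring

theorem det_re_pos (hL : IsCFM 2 D L) (hp : p ∈ D) : 0 < (gmat L p).det.re := by
  have h0 : 0 < (gm L 0 0 p).re := by
    simpa using hL.posdef p hp (Pi.single 0 1) (by simp)
  have h1 : (gm L 0 0 p).im = 0 := Complex.conj_eq_iff_im.1 (hL.hermitian p hp 0 0)
  have h2 := hL.posdef p hp ![-gm L 1 0 p, gm L 0 0 p] fun h => by
    have := congrFun h 1
    simp only [Matrix.cons_val_one, Matrix.cons_val_fin_one, Pi.zero_apply] at this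
    simp [this] at h0
  have h3 : (∑ i, ∑ j, gm L i j p * (![-gm L 1 0 p, gm L 0 0 p] : Fin 2 → ℂ) i *
      (starRingEnd ℂ) ((![-gm L 1 0 p, gm L 0 0 p] : Fin 2 → ℂ) j)) =
      (gmat L p).det * gm L 0 0 p := by
    simp only [Fin.sum_univ_two, Matrix.cons_val_zero, Matrix.cons_val_one,
      Matrix.cons_val_fin_one, map_neg, hL.hermitian p hp, det_gmat]
    ring
  rw [h3, mul_re, h1, mul_zero, sub_zero] at h2
  exact pos_of_mul_pos_left h2 h0.le

theorem det_ne (hL : IsCFM 2 D L) (hp : p ∈ D) : (gmat L p).det ≠ 0 := fun h => by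
  simpa [h] using hL.det_re_pos hp

theorem sg_mul (hL : IsCFM 2 D L) (hp : p ∈ D) : sg L p * sg L p = (gmat L p).det := by
  rw [sg, ← ofReal_mul, Real.mul_self_sqrt (hL.det_re_pos hp).le]
  apply Complex.ext <;> simp [hL.det_im hp]

theorem sg_ne (hL : IsCFM 2 D L) (hp : p ∈ D) : sg L p ≠ 0 := by
  rw [sg, ofReal_ne_zero]
  exact (Real.sqrt_pos.2 (hL.det_re_pos hp)).ne'

theorem sm_det (hL : IsCFM 2 D L) : Sm D (fun q => (gmat L q).det) :=
  (((hL.sm_gm 0 0).mul (hL.sm_gm 1 1)).sub ((hL.sm_gm 0 1).mul (hL.sm_gm 1 0))).congr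
    fun q _ => det_gmat L q

theorem sm_sg (hL : IsCFM 2 D L) : Sm D (sg L) := sm_sqrt hL.sm_det fun _ hq => hL.det_re_pos hq

theorem sm_mup (hL : IsCFM 2 D L) (i : Fin 2) : Sm D (mup L i) := by
  have hs := hL.sm_sg.inv fun _ hq => hL.sg_ne hq
  fin_cases i
  · exact ((hL.sm_llow 1).neg.mul hs).congr fun q _ => by simp [mup, div_eq_mul_inv]
  · exact ((hL.sm_llow 0).mul hs).congr fun q _ => by simp [mup, div_eq_mul_inv]

theorem sm_mlow (hL : IsCFM 2 D L) (i : Fin 2) : Sm D (mlow L i) :=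
  ContDiffOn.sum fun j _ => (hL.sm_gm i j).mul (hL.sm_mup j).conj

theorem sm_gi (hL : IsCFM 2 D L) (i j : Fin 2) : Sm D (gi L i j) := by
  have h : Sm D (fun q => ((gmat L q).det)⁻¹ * (gmat L q).adjugate i j) := by
    refine (hL.sm_det.inv fun _ hq => hL.det_ne hq).mul ?_
    simp only [Matrix.adjugate_fin_two]
    fin_cases i <;> fin_cases j
    · exact hL.sm_gm 1 1
    · exact (hL.sm_gm 0 1).neg
    · exact (hL.sm_gm 1 0).neg
    · exact hL.sm_gm 0 0
  exact h.congr fun q _ => by simp [gi, Matrix.inv_def, Ring.inverse_eq_inv']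

theorem sm_Cc (hL : IsCFM 2 D L) (i j k : Fin 2) : Sm D (Cc L i j k) :=
  ContDiffOn.sum fun l _ => (hL.sm_gi l i).mul ((hL.sm_gm j l).de hL.openD k)

theorem sm_sB (hL : IsCFM 2 D L) : Sm D (sB L) :=
  ContDiffOn.sum fun j _ => ContDiffOn.sum fun k _ => ContDiffOn.sum fun h _ =>
    (((hL.sm_mlow h).mul (hL.sm_mup k)).mul (hL.sm_mup j)).mul (hL.sm_Cc h j k)

theorem sm_vI (hL : IsCFM 2 D L) : Sm D (vI L) :=
  (ContDiffOn.sum fun s _ => (hL.sm_sB.debar hL.openD s).mul (hL.sm_mup s).conj).neg.sub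
    ((hL.sm_sB.mul hL.sm_sB.conj).div_const 2)

theorem hg_mup (hL : IsCFM 2 D L) (i : Fin 2) :
    Hg D (fun lam => (starRingEnd ℂ) lam / ‖lam‖) (mup L i) := by
  intro p hp lam h
  simp only [mup, hL.hg_llow _ p hp lam h, hL.hg_sg p hp lam h]
  split_ifs <;> ring

theorem hg_mlow (hL : IsCFM 2 D L) (i : Fin 2) : Hg D (fun lam => lam / ‖lam‖) (mlow L i) :=
  Hg.sum fun j => ((hL.hg_gm i j).mul (hL.hg_mup j).conj).congr fun lam _ => by simp

theorem hg_sB (hL : IsCFM 2 D L) :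
    Hg D (fun lam => ((starRingEnd ℂ) lam) ^ 2 / ‖lam‖ ^ 3) (sB L) :=
  Hg.sum fun j => Hg.sum fun k => Hg.sum fun h =>
    ((((hL.hg_mlow h).mul (hL.hg_mup k)).mul (hL.hg_mup j)).mul (hL.hg_Cc h j k)).congr
      fun lam hl => by
        have : (‖lam‖ : ℂ) ≠ 0 := by simpa using hl
        field_simp

theorem hg_vI (hL : IsCFM 2 D L) :
    Hg D (fun lam => (lam * (starRingEnd ℂ) lam)⁻¹) (vI L) := by
  have h1 : Hg D (fun lam => (lam * (starRingEnd ℂ) lam)⁻¹)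
      (fun q => ∑ s, debar (sB L) s q * (starRingEnd ℂ) (mup L s q)) :=
    Hg.sum fun s => ((hL.hg_sB.debar hL.openD s).mul (hL.hg_mup s).conj).congr fun lam hl => by
      have hn : (‖lam‖ : ℂ) ≠ 0 := by simpa using hl
      have hc : (starRingEnd ℂ) lam ≠ 0 := by simpa using hl
      have := Complex.mul_conj' lam
      simp only [map_div₀, map_inv₀, conj_conj, conj_ofReal]
      field_simp
      linear_combination (lam * (starRingEnd ℂ) lam + ‖lam‖ ^ 2) * this
  have h2 : Hg D (fun lam => (lam * (starRingEnd ℂ) lam)⁻¹)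
      (fun q => sB L q * (starRingEnd ℂ) (sB L q)) :=
    (hL.hg_sB.mul hL.hg_sB.conj).congr fun lam hl => by
      have hn : (‖lam‖ : ℂ) ≠ 0 := by simpa using hl
      have hc : (starRingEnd ℂ) lam ≠ 0 := by simpa using hl
      have := Complex.mul_conj' lam
      simp only [map_div₀, map_pow, conj_conj, conj_ofReal]
      field_simp
      linear_combination ((lam * (starRingEnd ℂ) lam) ^ 2 + lam * (starRingEnd ℂ) lam * ‖lam‖ ^ 2 +
        ‖lam‖ ^ 4) * this
  intro p hp lam h
  have e1 := h1 p hp lam h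
  have e2 := h2 p hp lam h
  simp only at e1 e2
  rw [vI, vI, e1, e2]
  ring

theorem sum_de_vI (hL : IsCFM 2 D L) (hp : p ∈ D) :
    ∑ k, de (vI L) k p * p.2 k = -vI L p := by
  have hd : HasFDerivAt (fun lam : ℂ => lam * (starRingEnd ℂ) lam) _ 1 :=
    (hasFDerivAt_id (𝕜 := ℝ) (1 : ℂ)).mul Complex.conjCLE.hasFDerivAt
  rw [hL.hg_vI.sum_de hp (hL.sm_vI.diff hL.openD hp)
    ((hasFDerivAt_inv' (𝕜 := ℝ) (by simp)).comp (1 : ℂ) hd)]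
  simp
  ring

theorem sum_gm_Cc (hL : IsCFM 2 D L) (hp : p ∈ D) (r j k : Fin 2) :
    ∑ i, gm L i r p * Cc L i j k p = de (gm L j r) k p := by
  have h := Matrix.nonsing_inv_mul (gmat L p) (isUnit_iff_ne_zero.2 (hL.det_ne hp))
  have h' (l : Fin 2) : ∑ i, gi L l i p * gm L i r p = (1 : Matrix (Fin 2) (Fin 2) ℂ) l r := by
    rw [← h]; rfl
  simp only [Cc, Finset.mul_sum]
  rw [Finset.sum_comm]
  calc ∑ l, ∑ i, gm L i r p * (gi L l i p * de (gm L j l) k p)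
      = ∑ l, (∑ i, gi L l i p * gm L i r p) * de (gm L j l) k p :=
        Finset.sum_congr rfl fun l _ => by
          rw [Finset.sum_mul]; exact Finset.sum_congr rfl fun i _ => by ring
    _ = _ := by simp [h', Matrix.one_apply]

theorem sum_Cc (hL : IsCFM 2 D L) (hp : p ∈ D) (i j : Fin 2) :
    ∑ k, Cc L i j k p * p.2 k = 0 := by
  simp only [Cc, Finset.sum_mul]
  rw [Finset.sum_comm]
  refine Finset.sum_eq_zero fun l _ => ?_
  simp only [mul_assoc]
  rw [← Finset.mul_sum, hL.sum_de_gm hp, mul_zero]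

theorem Cc_comm (hL : IsCFM 2 D L) (hp : p ∈ D) (i j k : Fin 2) :
    Cc L i j k p = Cc L i k j p :=
  Finset.sum_congr rfl fun l _ => by rw [hL.de_gm_comm hp]

theorem mup_zero_mul (hL : IsCFM 2 D L) (hp : p ∈ D) : mup L 0 p * sg L p = -llow L 1 p := by
  have := hL.sg_ne hp
  simp only [mup, if_true]; field_simp

theorem mup_one_mul (hL : IsCFM 2 D L) (hp : p ∈ D) : mup L 1 p * sg L p = llow L 0 p := by
  have := hL.sg_ne hp
  simp only [mup, one_ne_zero, if_false]; field_simp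

theorem conj_sg (L : Pt 2 → ℂ) (p : Pt 2) : (starRingEnd ℂ) (sg L p) = sg L p := conj_ofReal _

theorem conj_mup_zero (hL : IsCFM 2 D L) (hp : p ∈ D) :
    (starRingEnd ℂ) (mup L 0 p) = -debar L 1 p / (Fh L p * sg L p) := by
  have hs := hL.sg_ne hp
  have hF := hL.Fh_ne hp
  have := congrArg (starRingEnd ℂ) (hL.mup_zero_mul hp)
  rw [map_mul, conj_sg, map_neg, hL.conj_llow hp] at this
  field_simp at this ⊢
  exact this

theorem conj_mup_one (hL : IsCFM 2 D L) (hp : p ∈ D) :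
    (starRingEnd ℂ) (mup L 1 p) = debar L 0 p / (Fh L p * sg L p) := by
  have hs := hL.sg_ne hp
  have hF := hL.Fh_ne hp
  have := congrArg (starRingEnd ℂ) (hL.mup_one_mul hp)
  rw [map_mul, conj_sg, hL.conj_llow hp] at this
  field_simp at this ⊢
  exact this

theorem mlow_zero_mul (hL : IsCFM 2 D L) (hp : p ∈ D) :
    mlow L 0 p * Fh L p = -(sg L p * p.2 1) := by
  have hs := hL.sg_ne hp
  have hF := hL.Fh_ne hp
  have h2 := hL.sg_mul hp
  rw [det_gmat] at h2
  simp only [mlow, Fin.sum_univ_two, hL.conj_mup_zero hp, hL.conj_mup_one hp]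
  simp only [← hL.sum_gm hp, Fin.sum_univ_two]
  field_simp
  linear_combination (p.2 1) * h2

theorem mlow_one_mul (hL : IsCFM 2 D L) (hp : p ∈ D) :
    mlow L 1 p * Fh L p = sg L p * p.2 0 := by
  have hs := hL.sg_ne hp
  have hF := hL.Fh_ne hp
  have h2 := hL.sg_mul hp
  rw [det_gmat] at h2
  simp only [mlow, Fin.sum_univ_two, hL.conj_mup_zero hp, hL.conj_mup_one hp]
  simp only [← hL.sum_gm hp, Fin.sum_univ_two]
  field_simp
  linear_combination (-p.2 0) * h2

theorem sum_mlow_Cc (hL : IsCFM 2 D L) (hp : p ∈ D) (j k : Fin 2) :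
    ∑ h, mlow L h p * Cc L h j k p =
      ∑ r, (starRingEnd ℂ) (mup L r p) * de (gm L j r) k p := by
  simp only [mlow, ← hL.sum_gm_Cc hp, Finset.sum_mul, Finset.mul_sum]
  rw [Finset.sum_comm]
  exact Finset.sum_congr rfl fun i _ => Finset.sum_congr rfl fun r _ => by ring

theorem sB_eq (hL : IsCFM 2 D L) (hp : p ∈ D) :
    sB L p = ∑ j, ∑ r, mup L j p * (starRingEnd ℂ) (mup L r p) *
      ∑ k, de (gm L j r) k p * mup L k p := by
  have (j k : Fin 2) := hL.sum_mlow_Cc hp j k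
  simp only [Fin.sum_univ_two] at this
  simp only [sB, Fin.sum_univ_two]
  linear_combination mup L 0 p * mup L 0 p * this 0 0 + mup L 0 p * mup L 1 p * this 0 1 +
    mup L 1 p * mup L 0 p * this 1 0 + mup L 1 p * mup L 1 p * this 1 1

/-- The logarithmic derivative of `det g` along `m` is `B`. -/
theorem det_mul_sB (hL : IsCFM 2 D L) (hp : p ∈ D) (G : Fin 2 → Fin 2 → ℂ)
    (hG : ∀ j r, G j r = ∑ k, de (gm L j r) k p * mup L k p) :
    G 0 0 * gm L 1 1 p + gm L 0 0 p * G 1 1 - (G 0 1 * gm L 1 0 p + gm L 0 1 p * G 1 0) =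
      (gmat L p).det * sB L p := by
  have hs := hL.sg_ne hp
  have hF := hL.Fh_ne hp
  have e (r : Fin 2) : G 0 r * p.2 0 + G 1 r * p.2 1 = 0 := by
    have h0 := hL.sum_de_gm hp 0 r
    have h1 := hL.sum_de_gm hp 1 r
    have h2 := hL.de_gm_comm hp 0 r 1
    simp only [hG, Fin.sum_univ_two] at h0 h1 ⊢
    linear_combination mup L 0 p * h0 + mup L 1 p * h1 + (p.2 0 * mup L 1 p - p.2 1 * mup L 0 p) * h2
  have hm0 : mup L 0 p = -de L 1 p / (Fh L p * sg L p) := by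
    have := hL.mup_zero_mul hp
    rw [hL.llow_eq hp] at this
    field_simp at this ⊢
    exact this
  have hm1 : mup L 1 p = de L 0 p / (Fh L p * sg L p) := by
    have := hL.mup_one_mul hp
    rw [hL.llow_eq hp] at this
    field_simp at this ⊢
    exact this
  have hF2 := hL.Fh_mul hp
  rw [← hL.sum_de_L hp, Fin.sum_univ_two] at hF2
  rw [← hL.sg_mul hp, hL.sB_eq hp]
  simp only [← hG]
  simp only [Fin.sum_univ_two, hL.conj_mup_zero hp, hL.conj_mup_one hp]
  simp only [hm0, hm1]
  simp only [← hL.sum_gm hp, Fin.sum_univ_two]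
  field_simp
  linear_combination (G 0 0 * gm L 1 1 p + gm L 0 0 p * G 1 1 -
    (G 0 1 * gm L 1 0 p + gm L 0 1 p * G 1 0)) * hF2 +
    (de L 0 p * gm L 1 1 p - de L 1 p * gm L 0 1 p) * e 0 +
    (de L 1 p * gm L 0 0 p - de L 0 p * gm L 1 0 p) * e 1

/-- The antiholomorphic derivative along `m̄` at `p`. -/
local notation "𝓥" => vbar (fun s => (starRingEnd ℂ) (mup L s p))

theorem vbar_gm (hL : IsCFM 2 D L) (hp : p ∈ D) (i j : Fin 2) :
    𝓥 (fderiv ℝ (gm L i j) p) = (starRingEnd ℂ) (∑ k, de (gm L j i) k p * mup L k p) := by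
  simp only [vbar_fderiv, hL.debar_gm hp, map_sum, map_mul]

theorem vbar_det (hL : IsCFM 2 D L) (hp : p ∈ D) :
    𝓥 (fderiv ℝ (fun q => (gmat L q).det) p) =
      (gmat L p).det * (starRingEnd ℂ) (sB L p) := by
  have hg (i j : Fin 2) := (hL.sm_gm i j).diff hL.openD hp
  have h1 := congrArg (starRingEnd ℂ) (hL.det_mul_sB hp _ fun _ _ => rfl)
  rw [map_mul, Complex.conj_eq_iff_im.2 (hL.det_im hp)] at h1
  rw [← h1]
  simp only [det_gmat]
  rw [fderiv_fun_sub ((hg 0 0).fun_mul (hg 1 1)) ((hg 0 1).fun_mul (hg 1 0)), map_sub,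
    map_fderiv_mul _ (hg 0 0) (hg 1 1), map_fderiv_mul _ (hg 0 1) (hg 1 0)]
  simp only [hL.vbar_gm hp, map_add, map_sub, map_mul, hL.hermitian p hp]
  ring

theorem vbar_sg (hL : IsCFM 2 D L) (hp : p ∈ D) :
    𝓥 (fderiv ℝ (sg L) p) = sg L p * (starRingEnd ℂ) (sB L p) / 2 := by
  have hs := hL.sm_sg.diff hL.openD hp
  have h := hL.vbar_det hp
  rw [← fderiv_eq_of_eqOn hL.openD (fun q hq => hL.sg_mul hq) hp, map_fderiv_mul _ hs hs,
    ← hL.sg_mul hp] at h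
  apply mul_left_cancel₀ (hL.sg_ne hp)
  linear_combination h / 2

theorem vbar_Fh (hL : IsCFM 2 D L) (hp : p ∈ D) : 𝓥 (fderiv ℝ (Fh L) p) = 0 := by
  have hF := hL.sm_Fh.diff hL.openD hp
  have h : 𝓥 (fderiv ℝ L p) = 0 := by
    rw [vbar_fderiv, Fin.sum_univ_two, hL.conj_mup_zero hp, hL.conj_mup_one hp]
    ring
  rw [← fderiv_eq_of_eqOn hL.openD (fun q hq => hL.Fh_mul hq) hp, map_fderiv_mul _ hF hF] at h
  apply mul_left_cancel₀ (hL.Fh_ne hp)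
  linear_combination h / 2

theorem vbar_llow (hL : IsCFM 2 D L) (hp : p ∈ D) (i : Fin 2) :
    𝓥 (fderiv ℝ (llow L i) p) = mlow L i p / Fh L p := by
  have hF := hL.Fh_ne hp
  have h : 𝓥 (fderiv ℝ (de L i) p) = mlow L i p := by
    simp only [vbar_fderiv, mlow, hL.gm_eq hp]
  rw [← fderiv_eq_of_eqOn (f := fun q => llow L i q * Fh L q) hL.openD (fun q hq => by
      rw [hL.llow_eq hq, div_mul_cancel₀ _ (hL.Fh_ne hq)]) hp,
    map_fderiv_mul _ ((hL.sm_llow i).diff hL.openD hp) (hL.sm_Fh.diff hL.openD hp),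
    hL.vbar_Fh hp] at h
  field_simp
  linear_combination h

theorem vbar_mup (hL : IsCFM 2 D L) (hp : p ∈ D) (i : Fin 2) :
    𝓥 (fderiv ℝ (mup L i) p) =
      -p.2 i / L p - mup L i p * (starRingEnd ℂ) (sB L p) / 2 := by
  have hF := hL.Fh_ne hp
  have hs := hL.sg_ne hp
  have hd (i) := (hL.sm_mup i).diff hL.openD hp
  have hds := hL.sm_sg.diff hL.openD hp
  rw [← hL.Fh_mul hp]
  fin_cases i
  · have h1 := congrArg 𝓥 (fderiv_eq_of_eqOn hL.openD (fun q hq => hL.mup_zero_mul hq) hp)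
    have h2 := hL.mlow_one_mul hp
    rw [map_fderiv_mul _ (hd 0) hds, map_fderiv_neg, hL.vbar_llow hp, hL.vbar_sg hp] at h1
    simp only [Fin.zero_eta]
    field_simp at h1 ⊢
    apply mul_left_cancel₀ hs
    linear_combination (Fh L p) * h1 - 2 * h2
  · have h1 := congrArg 𝓥 (fderiv_eq_of_eqOn hL.openD (fun q hq => hL.mup_one_mul hq) hp)
    have h2 := hL.mlow_zero_mul hp
    rw [map_fderiv_mul _ (hd 1) hds, hL.vbar_llow hp, hL.vbar_sg hp] at h1
    simp only [Fin.mk_one]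
    field_simp at h1 ⊢
    apply mul_left_cancel₀ hs
    linear_combination (Fh L p) * h1 + 2 * h2

theorem debar_snd (h k : Fin 2) (p : Pt 2) : debar (fun q : Pt 2 => q.2 k) h p = 0 := by
  have : fderiv ℝ (fun q : Pt 2 => q.2 k) p =
      (ContinuousLinearMap.proj k).comp (ContinuousLinearMap.snd ℝ (Fin 2 → ℂ) (Fin 2 → ℂ)) :=
    ((ContinuousLinearMap.proj (R := ℝ) (φ := fun _ : Fin 2 => ℂ) k).comp
      (ContinuousLinearMap.snd ℝ (Fin 2 → ℂ) (Fin 2 → ℂ))).hasFDerivAt.fderiv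
  simp only [debar, this, single_I]
  simp only [ContinuousLinearMap.comp_apply, ContinuousLinearMap.coe_snd',
    ContinuousLinearMap.proj_apply, Pi.smul_apply, smul_eq_mul]
  linear_combination (1 / 2 * (Pi.single h 1 : Fin 2 → ℂ) k) * I_sq

theorem diff_snd (k : Fin 2) (p : Pt 2) : DifferentiableAt ℝ (fun q : Pt 2 => q.2 k) p :=
  ((ContinuousLinearMap.proj (R := ℝ) (φ := fun _ : Fin 2 => ℂ) k).comp
      (ContinuousLinearMap.snd ℝ (Fin 2 → ℂ) (Fin 2 → ℂ))).differentiableAt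

theorem vbar_mlow (hL : IsCFM 2 D L) (hp : p ∈ D) (i : Fin 2) :
    𝓥 (fderiv ℝ (mlow L i) p) = mlow L i p * (starRingEnd ℂ) (sB L p) / 2 := by
  have hF := hL.Fh_ne hp
  have hd (i) := (hL.sm_mlow i).diff hL.openD hp
  have hds := hL.sm_sg.diff hL.openD hp
  have hdF := hL.sm_Fh.diff hL.openD hp
  have hv (k : Fin 2) : 𝓥 (fderiv ℝ (fun q : Pt 2 => q.2 k) p) = 0 := by
    simp [vbar_fderiv, debar_snd]
  apply mul_left_cancel₀ hF
  fin_cases i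
  · have h1 := congrArg 𝓥 (fderiv_eq_of_eqOn hL.openD (fun q hq => hL.mlow_zero_mul hq) hp)
    have h2 := hL.mlow_zero_mul hp
    rw [map_fderiv_mul _ (hd 0) hdF, map_fderiv_neg, map_fderiv_mul _ hds (diff_snd 1 p), hv,
      hL.vbar_Fh hp, hL.vbar_sg hp] at h1
    simp only [Fin.zero_eta]
    linear_combination h1 - (starRingEnd ℂ) (sB L p) / 2 * h2
  · have h1 := congrArg 𝓥 (fderiv_eq_of_eqOn hL.openD (fun q hq => hL.mlow_one_mul hq) hp)
    have h2 := hL.mlow_one_mul hp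
    rw [map_fderiv_mul _ (hd 1) hdF, map_fderiv_mul _ hds (diff_snd 0 p), hv,
      hL.vbar_Fh hp, hL.vbar_sg hp] at h1
    simp only [Fin.mk_one]
    linear_combination h1 - (starRingEnd ℂ) (sB L p) / 2 * h2

theorem vbar_sB (hL : IsCFM 2 D L) (hp : p ∈ D) :
    𝓥 (fderiv ℝ (sB L) p) = (∑ j, ∑ k, ∑ h, mlow L h p * mup L k p * mup L j p *
      𝓥 (fderiv ℝ (Cc L h j k) p)) - sB L p * (starRingEnd ℂ) (sB L p) / 2 := by
  have dl (i) := (hL.sm_mlow i).diff hL.openD hp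
  have dm (i) := (hL.sm_mup i).diff hL.openD hp
  have dC (i j k) := (hL.sm_Cc i j k).diff hL.openD hp
  have step (j k h : Fin 2) : 𝓥 (fderiv ℝ (fun q => mlow L h q * mup L k q * mup L j q *
      Cc L h j k q) p) = mlow L h p * mup L k p * mup L j p * 𝓥 (fderiv ℝ (Cc L h j k) p)
        - mlow L h p * mup L k p * mup L j p * Cc L h j k p * (starRingEnd ℂ) (sB L p) / 2
        - mlow L h p * mup L j p / L p * (Cc L h j k p * p.2 k)
        - mlow L h p * mup L k p / L p * (Cc L h k j p * p.2 j) := by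
    rw [map_fderiv_mul _ (((dl h).fun_mul (dm k)).fun_mul (dm j)) (dC h j k),
      map_fderiv_mul _ ((dl h).fun_mul (dm k)) (dm j), map_fderiv_mul _ (dl h) (dm k),
      hL.vbar_mup hp, hL.vbar_mup hp, hL.vbar_mlow hp, hL.Cc_comm hp h k j]
    ring
  have hd (j k h : Fin 2) : DifferentiableAt ℝ (fun q => mlow L h q * mup L k q * mup L j q *
      Cc L h j k q) p := (((dl h).fun_mul (dm k)).fun_mul (dm j)).fun_mul (dC h j k)
  have h0 : sB L = fun q => ∑ j, ∑ k, ∑ h, mlow L h q * mup L k q * mup L j q * Cc L h j k q := rfl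
  have hz (i j : Fin 2) := hL.sum_Cc hp i j
  simp only [Fin.sum_univ_two] at hz
  conv_lhs => rw [h0]
  rw [map_fderiv_sum _ fun j => DifferentiableAt.fun_sum fun k _ =>
    DifferentiableAt.fun_sum fun h _ => hd j k h]
  simp only [map_fderiv_sum _ fun k => DifferentiableAt.fun_sum fun h _ => hd _ k h,
    map_fderiv_sum _ fun h => hd _ _ h, step]
  have hB : sB L p = ∑ j, ∑ k, ∑ h, mlow L h p * mup L k p * mup L j p * Cc L h j k p := rfl
  generalize (starRingEnd ℂ) (sB L p) = b
  rw [hB]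
  simp only [Fin.sum_univ_two]
  linear_combination
    (-2 * mlow L 0 p * mup L 0 p / L p) * hz 0 0 + (-2 * mlow L 0 p * mup L 1 p / L p) * hz 0 1 +
    (-2 * mlow L 1 p * mup L 0 p / L p) * hz 1 0 + (-2 * mlow L 1 p * mup L 1 p / L p) * hz 1 1

theorem sum_Sv_mup (hL : IsCFM 2 D L) (hp : p ∈ D) :
    ∑ r, ∑ j, ∑ h, ∑ k, Sv L r j h k p * (starRingEnd ℂ) (mup L r p) *
      mup L j p * (starRingEnd ℂ) (mup L h p) * mup L k p = vI L p := by
  have h := hL.vbar_sB hp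
  rw [vbar_fderiv] at h
  rw [vI, h]
  simp only [vbar_fderiv, Sv, mlow, Fin.sum_univ_two]
  ring

theorem sum_Sv_lup (hL : IsCFM 2 D L) (hp : p ∈ D) :
    ∑ r, ∑ j, ∑ h, ∑ k, Sv L r j h k p * (starRingEnd ℂ) (lup L r p) *
      lup L j p * (starRingEnd ℂ) (lup L h p) * lup L k p = 0 := by
  have hC (i j h : Fin 2) : ∑ k, debar (Cc L i j k) h p * p.2 k = 0 := by
    have hd (k) := (hL.sm_Cc i j k).diff hL.openD hp
    have h1 := congrArg (debarL h) (fderiv_eq_of_eqOn (g := fun _ => 0) hL.openD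
      (fun q hq => hL.sum_Cc hq i j) hp)
    rw [map_fderiv_sum _ fun k => (hd k).fun_mul (diff_snd k p)] at h1
    simp only [map_fderiv_mul _ (hd _) (diff_snd _ p), ← debar_eq, debar_snd] at h1
    simpa [debar_eq, mul_comm] using h1
  have hS (r j h : Fin 2) : ∑ k, Sv L r j h k p * p.2 k = 0 := by
    have h0 := hC 0 j h
    have h1 := hC 1 j h
    simp only [Sv, Fin.sum_univ_two] at h0 h1 ⊢
    linear_combination (-gm L 0 r p) * h0 - gm L 1 r p * h1
  refine Finset.sum_eq_zero fun r _ => Finset.sum_eq_zero fun j _ =>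
    Finset.sum_eq_zero fun h _ => ?_
  calc _ = (starRingEnd ℂ) (lup L r p) * lup L j p * (starRingEnd ℂ) (lup L h p) / Fh L p *
        ∑ k, Sv L r j h k p * p.2 k := by
        rw [Finset.mul_sum]
        exact Finset.sum_congr rfl fun k _ => by rw [lup, lup, lup, lup]; ring
    _ = 0 := by rw [hS, mul_zero]

theorem Sv_eq (hL : IsCFM 2 D L) (hp : p ∈ D) (r j h k : Fin 2) :
    Sv L r j h k p = -debar (de (gm L j r) k) h p +
      ∑ i, debar (gm L i r) h p * Cc L i j k p := by
  have h1 := congrArg (debarL h) (fderiv_eq_of_eqOn hL.openD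
    (fun q hq => hL.sum_gm_Cc hq r j k) hp)
  have hg (i) := (hL.sm_gm i r).diff hL.openD hp
  have hC (i) := (hL.sm_Cc i j k).diff hL.openD hp
  rw [map_fderiv_sum _ fun i => (hg i).fun_mul (hC i)] at h1
  simp only [map_fderiv_mul _ (hg _) (hC _), ← debar_eq, Fin.sum_univ_two] at h1
  simp only [Sv, Fin.sum_univ_two]
  linear_combination -h1

theorem conj_debar_de_gm (hL : IsCFM 2 D L) (hp : p ∈ D) (r j h k : Fin 2) :
    (starRingEnd ℂ) (debar (de (gm L j r) k) h p) = debar (de (gm L r j) h) k p := by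
  rw [← de_conj, (hL.sm_gm r j).debar_de hL.openD hp, de_eq, de_eq]
  congr 1
  refine fderiv_eq_of_eqOn hL.openD (fun q hq => ?_) hp
  rw [hL.debar_gm hq]

theorem vI_im (hL : IsCFM 2 D L) (hp : p ∈ D) : (vI L p).im = 0 := by
  rw [← Complex.conj_eq_iff_im, ← hL.sum_Sv_mup hp]
  have hP (i h r : Fin 2) : debar (gm L i r) h p =
      ∑ a, gm L i a p * (starRingEnd ℂ) (Cc L a r h p) := by
    rw [hL.debar_gm hp, ← hL.sum_gm_Cc hp]
    simp only [map_sum, map_mul, hL.hermitian p hp]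
  simp only [hL.Sv_eq hp, hP, Fin.sum_univ_two, map_add, map_mul, map_neg, conj_conj,
    hL.conj_debar_de_gm hp, hL.hermitian p hp]
  ring

end dimTwo

end IsCFM

/-- vertical holomorphic sectional curvatures in directions `l` and `m`,
reality of `I`, and `(∂I/∂η^k) η^k = −I`. -/
theorem statement3 (D : Set (Pt 2)) (L : Pt 2 → ℂ) (hL : IsCFM 2 D L) :
    ∀ p ∈ D,
      (∑ r, ∑ j, ∑ h, ∑ k, Sv L r j h k p * (starRingEnd ℂ) (lup L r p) *
        lup L j p * (starRingEnd ℂ) (lup L h p) * lup L k p) = 0 ∧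
      (∑ r, ∑ j, ∑ h, ∑ k, Sv L r j h k p * (starRingEnd ℂ) (mup L r p) *
        mup L j p * (starRingEnd ℂ) (mup L h p) * mup L k p) = vI L p ∧
      (vI L p).im = 0 ∧
      (∑ k, de (vI L) k p * p.2 k) = -(vI L p) := by
  exact fun p hp => ⟨hL.sum_Sv_lup hp, hL.sum_Sv_mup hp, hL.vI_im hp, hL.sum_de_vI hp⟩

end CFinsler
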